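/- Pointwise bound on the Landau coefficients (Lemma 2.2(B)(c)): for every k ∈ ℝ there exist constants C_k > 0 and C > 0 (with C independent of k) such that for every Schwartz function h on ℝ³ and every v ∈ ℝ³: |A[h](v)| + |a[h](v)| ≤ C_k ⟨v⟩^{−k} ∫_{|v−v₁| ≤ ⟨v⟩/2} ( ⟨v₁⟩^{1+k} |h(v₁)| / |v−v₁|² ) dv₁ + C ‖h‖_{L¹(ℝ³)}, where |A[h](v)| denotes any fixed matrix norm. -/

import Mathlib

open MeasureTheory Set
open scoped ENNReal

noncomputable section

/-- The Japanese bracket `⟨v⟩ = (1+|v|²)^(1/2)` on `ℝ³`. -/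
def jap (v : EuclideanSpace ℝ (Fin 3)) : ℝ := Real.sqrt (1 + ‖v‖ ^ 2)

/-- Partial derivative in the `i`-th coordinate direction. -/
def pd (i : Fin 3) (φ : EuclideanSpace ℝ (Fin 3) → ℝ) (v : EuclideanSpace ℝ (Fin 3)) : ℝ :=
  fderiv ℝ φ v (EuclideanSpace.single i 1)

/-- Iterated partial derivative along a list of coordinate directions (a multi-index). -/
def pdMany : List (Fin 3) → (EuclideanSpace ℝ (Fin 3) → ℝ) → EuclideanSpace ℝ (Fin 3) → ℝ
  | [], φ => φ
  | i :: l, φ => pd i (pdMany l φ)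

/-- The projection kernel `P(z) = Id − z⊗z/|z|²`. -/
def Pker (z : EuclideanSpace ℝ (Fin 3)) (i j : Fin 3) : ℝ :=
  (if i = j then (1 : ℝ) else 0) - z i * z j / ‖z‖ ^ 2

/-- The Landau matrix `A[h](v) = (1/(8π)) ∫ (P(v−z)/|v−z|) h(z) dz` (entry `(i,j)`). -/
def LandauA (h : EuclideanSpace ℝ (Fin 3) → ℝ) (v : EuclideanSpace ℝ (Fin 3)) (i j : Fin 3) : ℝ :=
  (1 / (8 * Real.pi)) * ∫ z, Pker (v - z) i j / ‖v - z‖ * h z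

/-- The Landau potential `a[h](v) = (1/(4π)) ∫ h(z)/|v−z| dz`. -/
def landaua (h : EuclideanSpace ℝ (Fin 3) → ℝ) (v : EuclideanSpace ℝ (Fin 3)) : ℝ :=
  (1 / (4 * Real.pi)) * ∫ z, h z / ‖v - z‖

/-- The Bessel potential operator `𝓜 = (I − Δ)⁻¹` via its integral kernel. -/
def besselM (h : EuclideanSpace ℝ (Fin 3) → ℝ) (v : EuclideanSpace ℝ (Fin 3)) : ℝ :=
  (1 / (4 * Real.pi)) * ∫ z, Real.exp (-‖v - z‖) / ‖v - z‖ * h z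

/-- Squared euclidean norm of the gradient. -/
def gradNormSq (φ : EuclideanSpace ℝ (Fin 3) → ℝ) (v : EuclideanSpace ℝ (Fin 3)) : ℝ :=
  ∑ i, (pd i φ v) ^ 2

/-- Euclidean norm of the gradient. -/
def gradNorm (φ : EuclideanSpace ℝ (Fin 3) → ℝ) (v : EuclideanSpace ℝ (Fin 3)) : ℝ :=
  Real.sqrt (gradNormSq φ v)

lemma jap_pos (v : EuclideanSpace ℝ (Fin 3)) : 0 < jap v :=
  Real.sqrt_pos.2 (by positivity)

lemma one_le_jap (v : EuclideanSpace ℝ (Fin 3)) : 1 ≤ jap v :=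
  Real.one_le_sqrt.2 (by nlinarith [sq_nonneg ‖v‖])

lemma jap_sq (v : EuclideanSpace ℝ (Fin 3)) : jap v ^ 2 = 1 + ‖v‖ ^ 2 :=
  Real.sq_sqrt (by positivity)

lemma jap_lip (v w : EuclideanSpace ℝ (Fin 3)) : jap v ≤ jap w + ‖v - w‖ := by
  have h1 : ‖v‖ ≤ ‖w‖ + ‖v - w‖ := by
    have := norm_add_le w (v - w)
    simpa using this
  have h2 : ‖w‖ ≤ jap w := Real.le_sqrt_of_sq_le (by linarith)
  have h3 := jap_pos w
  have h4 := norm_nonneg (v - w)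
  have h5 := norm_nonneg v
  apply Real.sqrt_le_iff.2
  refine ⟨by positivity, ?_⟩
  have := jap_sq w
  nlinarith [mul_le_mul_of_nonneg_right h2 h4]

lemma jap_cont : Continuous jap := by
  unfold jap
  fun_prop

lemma Pker_abs_le (z : EuclideanSpace ℝ (Fin 3)) (i j : Fin 3) : |Pker z i j| ≤ 2 := by
  unfold Pker
  have hi : |z i| ≤ ‖z‖ := by simpa using PiLp.norm_apply_le z i
  have hj : |z j| ≤ ‖z‖ := by simpa using PiLp.norm_apply_le z j
  have h1 : |z i * z j / ‖z‖ ^ 2| ≤ 1 := by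
    rw [abs_div, abs_mul, abs_of_nonneg (sq_nonneg ‖z‖)]
    apply div_le_one_of_le₀ _ (sq_nonneg _)
    rw [sq]
    exact mul_le_mul hi hj (abs_nonneg _) (norm_nonneg _)
  have h2 : |(if i = j then (1 : ℝ) else 0)| ≤ 1 := by split_ifs <;> simp
  rw [abs_le] at h1 h2 ⊢
  constructor <;> linarith [h1.1, h1.2, h2.1, h2.2]

lemma ratio_bound (k t : ℝ) (h1 : 1 / 2 ≤ t) (h2 : t ≤ 2) :
    1 ≤ (2 : ℝ) ^ |1 + k| * t ^ (1 + k) := by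
  have ht : 0 < t := by linarith
  rcases le_total 0 (1 + k) with h | h
  · rw [abs_of_nonneg h, ← Real.mul_rpow (by norm_num) ht.le]
    exact Real.one_le_rpow (by linarith) h
  · rw [abs_of_nonpos h, Real.rpow_neg (by norm_num), ← Real.inv_rpow (by norm_num),
      ← Real.mul_rpow (by norm_num) ht.le]
    exact Real.one_le_rpow_of_pos_of_le_one_of_nonpos (by positivity) (by linarith) h

lemma near_bound (k : ℝ) (v z : EuclideanSpace ℝ (Fin 3)) (hz : ‖v - z‖ ≤ jap v / 2) :
    1 / ‖v - z‖ ≤ (2 : ℝ) ^ |1 + k| * jap v ^ (-k) * (jap z ^ (1 + k) / ‖v - z‖ ^ 2) := by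
  have hv := jap_pos v
  have hzp := jap_pos z
  have l1 := jap_lip v z
  have l2 := jap_lip z v
  rw [norm_sub_rev] at l2
  have hr := ratio_bound k (jap z / jap v) (by rw [le_div_iff₀ hv]; linarith)
    (by rw [div_le_iff₀ hv]; linarith)
  rw [Real.div_rpow hzp.le hv.le] at hr
  have key : jap v ≤ (2 : ℝ) ^ |1 + k| * jap v ^ (-k) * jap z ^ (1 + k) := by
    have e : jap v ^ (-k) = jap v / jap v ^ (1 + k) := by
      rw [eq_div_iff (by positivity), ← Real.rpow_add hv]
      simp
    rw [e]
    calc jap v = 1 * jap v := by ring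
      _ ≤ _ := mul_le_mul_of_nonneg_right hr hv.le
      _ = _ := by ring
  rcases (norm_nonneg (v - z)).eq_or_lt with h0 | h0
  · rw [← h0]; simp
  · rw [← mul_div_assoc, div_le_div_iff₀ h0 (by positivity)]
    nlinarith

lemma near_int (k : ℝ) (h : SchwartzMap (EuclideanSpace ℝ (Fin 3)) ℝ)
    (v : EuclideanSpace ℝ (Fin 3)) :
    IntegrableOn (fun v₁ => jap v₁ ^ (1 + k) * |h v₁| / ‖v - v₁‖ ^ 2)
      {v₁ : EuclideanSpace ℝ (Fin 3) | ‖v - v₁‖ ≤ jap v / 2} := by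
  have hS : {v₁ : EuclideanSpace ℝ (Fin 3) | ‖v - v₁‖ ≤ jap v / 2}
      = Metric.closedBall v (jap v / 2) := by
    ext z; simp [dist_eq_norm, norm_sub_rev]
  have hc : Continuous (fun v₁ => jap v₁ ^ (1 + k) * |h v₁|) :=
    (jap_cont.rpow_const (fun x => Or.inl (jap_pos x).ne')).mul h.continuous.abs
  have hk : IntegrableOn (fun v₁ => 1 / ‖v - v₁‖ ^ 2) (Metric.closedBall v (jap v / 2)) := by
    set R := jap v / 2
    have hb : Integrable (fun x : EuclideanSpace ℝ (Fin 3) =>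
        (Set.Iic R).indicator (fun r : ℝ => 1 / r ^ 2) ‖x‖) := by
      rw [integrable_fun_norm_addHaar (volume : Measure (EuclideanSpace ℝ (Fin 3)))
        (f := (Set.Iic R).indicator (fun r : ℝ => 1 / r ^ 2))]
      have : IntegrableOn (fun _ : ℝ => (1 : ℝ)) (Set.Ioc 0 R) := by
        simp
      have h3 := (this.integrable_indicator measurableSet_Ioc).integrableOn (s := Set.Ioi 0)
      refine h3.congr_fun ?_ measurableSet_Ioi
      intro r hr
      have hr' : (0 : ℝ) < r := hr
      by_cases hR : r ≤ R
      · simp [Set.indicator, hR, hr', hr'.ne']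
      · simp [Set.indicator, hR]
    have h4 := hb.comp_sub_left v
    rw [← integrable_indicator_iff measurableSet_closedBall]
    refine h4.congr (Filter.Eventually.of_forall fun z => ?_)
    simp only [Set.indicator, Set.mem_Iic, Metric.mem_closedBall, dist_eq_norm, norm_sub_rev z v]
  rw [hS]
  have := hk.continuousOn_mul hc.continuousOn (isCompact_closedBall _ _)
  refine this.congr_fun (fun z _ => ?_) measurableSet_closedBall
  simp [div_eq_mul_inv]

/-- Lemma 2.2(B)(c): pointwise bound on the Landau coefficients,
`|A[h](v)| + |a[h](v)| ≤ C_k ⟨v⟩^{−k} ∫_{|v−v₁|≤⟨v⟩/2} ⟨v₁⟩^{1+k}|h(v₁)|/|v−v₁|² dv₁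
  + C ‖h‖_{L¹}`, with `C` independent of `k`. -/
theorem landau_coefficients_pointwise_bound :
    ∃ C > 0, ∀ k : ℝ, ∃ Ck > 0, ∀ h : SchwartzMap (EuclideanSpace ℝ (Fin 3)) ℝ,
      ∀ v : EuclideanSpace ℝ (Fin 3),
      (∑ i, ∑ j, |LandauA (⇑h) v i j|) + |landaua (⇑h) v|
        ≤ Ck * jap v ^ (-k) *
            (∫ v₁ in {v₁ : EuclideanSpace ℝ (Fin 3) | ‖v - v₁‖ ≤ jap v / 2},
              jap v₁ ^ (1 + k) * |h v₁| / ‖v - v₁‖ ^ 2) +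
          C * ∫ v₁, |h v₁| := by
  refine ⟨38, by norm_num, fun k => ⟨19 * (2 : ℝ) ^ |1 + k|, by positivity, fun h v => ?_⟩⟩
  set S := {v₁ : EuclideanSpace ℝ (Fin 3) | ‖v - v₁‖ ≤ jap v / 2} with hSdef
  set g := fun v₁ => jap v₁ ^ (1 + k) * |h v₁| / ‖v - v₁‖ ^ 2 with hg
  have hv := jap_pos v
  have hSm : MeasurableSet S := measurableSet_le (by fun_prop) (by fun_prop)
  have hgi : Integrable (S.indicator g) := (near_int k h v).integrable_indicator hSm
  have hhi : Integrable (fun z => |h z|) := h.integrable.abs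
  set c := (2 : ℝ) ^ |1 + k| * jap v ^ (-k) with hcdef
  have hc : 0 ≤ c := by positivity
  set G := fun z => c * S.indicator g z + 2 * |h z| with hG
  have hGi : Integrable G := (hgi.const_mul c).add (hhi.const_mul 2)
  have hGv : ∫ z, G z = c * (∫ z in S, g z) + 2 * ∫ z, |h z| := by
    rw [hG, integral_add (hgi.const_mul c) (hhi.const_mul 2), integral_const_mul,
      integral_const_mul, integral_indicator hSm]
  have hpt : ∀ z, |h z| / ‖v - z‖ ≤ G z := by
    intro z
    by_cases hz : z ∈ S
    · have := mul_le_mul_of_nonneg_right (near_bound k v z hz) (abs_nonneg (h z))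
      simp only [hG, Set.indicator_of_mem hz, hg]
      calc _ = 1 / ‖v - z‖ * |h z| := by ring
        _ ≤ _ := this
        _ = c * (jap z ^ (1 + k) * |h z| / ‖v - z‖ ^ 2) := by rw [hcdef]; ring
        _ ≤ _ := by linarith [abs_nonneg (h z)]
    · simp only [hG, Set.indicator_of_notMem hz]
      have hz' : jap v / 2 < ‖v - z‖ := not_le.1 hz
      have h1 := one_le_jap v
      rw [div_le_iff₀ (by linarith)]
      nlinarith [abs_nonneg (h z)]
  have hG0 : 0 ≤ ∫ z, G z :=
    integral_nonneg fun z => le_trans (by positivity) (hpt z)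
  have hpi := Real.pi_gt_three
  have ha : |landaua (⇑h) v| ≤ ∫ z, G z := by
    unfold landaua
    rw [abs_mul]
    have h1 : |1 / (4 * Real.pi)| ≤ 1 := by
      rw [abs_of_pos (by positivity)]
      exact div_le_one_of_le₀ (by linarith) (by positivity)
    have h2 : |∫ z, h z / ‖v - z‖| ≤ ∫ z, G z := by
      rw [← Real.norm_eq_abs]
      refine norm_integral_le_of_norm_le hGi (Filter.Eventually.of_forall fun z => ?_)
      rw [norm_div, norm_norm, Real.norm_eq_abs]
      exact hpt z
    calc _ ≤ 1 * ∫ z, G z := mul_le_mul h1 h2 (abs_nonneg _) zero_le_one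
      _ = _ := one_mul _
  have hA : ∀ i j, |LandauA (⇑h) v i j| ≤ 2 * ∫ z, G z := by
    intro i j
    unfold LandauA
    rw [abs_mul]
    have h1 : |1 / (8 * Real.pi)| ≤ 1 := by
      rw [abs_of_pos (by positivity)]
      exact div_le_one_of_le₀ (by linarith) (by positivity)
    have h2 : |∫ z, Pker (v - z) i j / ‖v - z‖ * h z| ≤ ∫ z, 2 * G z := by
      rw [← Real.norm_eq_abs]
      refine norm_integral_le_of_norm_le (hGi.const_mul 2)
        (Filter.Eventually.of_forall fun z => ?_)
      rw [norm_mul, norm_div, norm_norm, Real.norm_eq_abs, Real.norm_eq_abs]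
      calc _ = |Pker (v - z) i j| * (|h z| / ‖v - z‖) := by ring
        _ ≤ 2 * G z := mul_le_mul (Pker_abs_le _ _ _) (hpt z) (by positivity) (by norm_num)
    rw [integral_const_mul] at h2
    calc _ ≤ 1 * (2 * ∫ z, G z) := mul_le_mul h1 h2 (abs_nonneg _) zero_le_one
      _ = _ := one_mul _
  have hsum : ∑ i, ∑ j, |LandauA (⇑h) v i j| ≤ ∑ _i : Fin 3, ∑ _j : Fin 3, 2 * ∫ z, G z :=
    Finset.sum_le_sum fun i _ => Finset.sum_le_sum fun j _ => hA i j
  simp only [Finset.sum_const, Finset.card_univ, Fintype.card_fin, nsmul_eq_mul] at hsum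
  push_cast at hsum
  have e : 19 * (2 : ℝ) ^ |1 + k| * jap v ^ (-k) = 19 * c := by rw [hcdef]; ring
  rw [e]
  rw [hGv] at hsum ha
  linarith
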